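/- arXiv:1901.07735 — 4 statements merged into one kernel-verified Lean document; each statement's English description precedes it below -/
import Mathlib

section
/- Let G be the sibling tree ST_n with n ≥ 1. Then the total domination number of G is γ_t(G) = (2^{n+2}+3)/7 if n ≡ 0 (mod 3), γ_t(G) = (2^{n+2}-1)/7 + 1 if n ≡ 1 (mod 3), and γ_t(G) = 2(2^{n+1}-1)/7 if n ≡ 2 (mod 3). -/
/-- Vertex labels of a level-`n` complete binary tree: `1, …, 2^(n+1) - 1`. -/
def treeVerts (n : ℕ) : Finset ℕ := Finset.Icc 1 (2 ^ (n + 1) - 1)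

/-- The hypertree `HT(n)`: each vertex `x` is adjacent to its children `2x` and `2x+1`
(when the labels lie in the vertex set), and two vertices at the same level `i`
(`1 ≤ i ≤ n`, i.e. `2^i ≤ x < 2^(i+1)`) are adjacent iff their labels differ by `2^(i-1)`. -/
def hyperTree (n : ℕ) : SimpleGraph ℕ :=
  SimpleGraph.fromRel (fun x y =>
    x ∈ treeVerts n ∧ y ∈ treeVerts n ∧
      (y = 2 * x ∨ y = 2 * x + 1 ∨
        ∃ i, 1 ≤ i ∧ i ≤ n ∧ 2 ^ i ≤ x ∧ x < 2 ^ (i + 1) ∧ 2 ^ i ≤ y ∧ y < 2 ^ (i + 1) ∧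
          y = x + 2 ^ (i - 1)))

/-- The root-fault hypertree `HT*(n)`: the induced subgraph of `HT(n)` obtained by
deleting the root vertex `1`. -/
def rootFaultHyperTree (n : ℕ) : SimpleGraph ℕ :=
  SimpleGraph.fromRel (fun x y => x ≠ 1 ∧ y ≠ 1 ∧ (hyperTree n).Adj x y)

/-- Vertex labels of the root-fault hypertree `HT*(n)`: `2, …, 2^(n+1) - 1`. -/
def rootFaultVerts (n : ℕ) : Finset ℕ := Finset.Icc 2 (2 ^ (n + 1) - 1)

/-- The sibling tree `ST_n`: each vertex `x` is adjacent to its children `2x` and `2x+1`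
(when the labels lie in the vertex set), and the two children `2p`, `2p+1` of a common
parent are adjacent. -/
def siblingTree (n : ℕ) : SimpleGraph ℕ :=
  SimpleGraph.fromRel (fun x y =>
    x ∈ treeVerts n ∧ y ∈ treeVerts n ∧
      (y = 2 * x ∨ y = 2 * x + 1 ∨ ∃ p, x = 2 * p ∧ y = 2 * p + 1))

/-- `S` is a dominating set of the graph `G` with (finite) vertex set `V`:
every vertex of `V` not in `S` is adjacent to some vertex of `S`. -/
def IsDomSetOn (G : SimpleGraph ℕ) (V S : Finset ℕ) : Prop :=
  S ⊆ V ∧ ∀ v ∈ V, v ∉ S → ∃ u ∈ S, G.Adj u v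

/-- `S` is a total dominating set of the graph `G` with (finite) vertex set `V`:
every vertex of `V` is adjacent to some vertex of `S`. -/
def IsTotalDomSetOn (G : SimpleGraph ℕ) (V S : Finset ℕ) : Prop :=
  S ⊆ V ∧ ∀ v ∈ V, ∃ u ∈ S, G.Adj u v

/-- `S` locates the vertices of `V` outside `S`: any two distinct vertices `u, v` of `V`
outside `S` satisfy `N(u) ∩ S ≠ N(v) ∩ S`. -/
def LocatesOn (G : SimpleGraph ℕ) (V S : Finset ℕ) : Prop :=
  ∀ u ∈ V, ∀ v ∈ V, u ∉ S → v ∉ S → u ≠ v →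
    ({w : ℕ | w ∈ S ∧ G.Adj w u} ≠ {w : ℕ | w ∈ S ∧ G.Adj w v})

/-- `S` is a locating-dominating set of `G` with vertex set `V`. -/
def IsLocDomSetOn (G : SimpleGraph ℕ) (V S : Finset ℕ) : Prop :=
  IsDomSetOn G V S ∧ LocatesOn G V S

/-- `S` is a locating-total dominating set of `G` with vertex set `V`. -/
def IsLocTotalDomSetOn (G : SimpleGraph ℕ) (V S : Finset ℕ) : Prop :=
  IsTotalDomSetOn G V S ∧ LocatesOn G V S

/-- The domination number `γ` of the graph `G` with vertex set `V`. -/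
noncomputable def domNum (G : SimpleGraph ℕ) (V : Finset ℕ) : ℕ :=
  sInf {k | ∃ S : Finset ℕ, IsDomSetOn G V S ∧ S.card = k}

/-- The total domination number `γ_t` of the graph `G` with vertex set `V`. -/
noncomputable def totalDomNum (G : SimpleGraph ℕ) (V : Finset ℕ) : ℕ :=
  sInf {k | ∃ S : Finset ℕ, IsTotalDomSetOn G V S ∧ S.card = k}

/-- The locating-domination number `γ^L` of the graph `G` with vertex set `V`. -/
noncomputable def locDomNum (G : SimpleGraph ℕ) (V : Finset ℕ) : ℕ :=
  sInf {k | ∃ S : Finset ℕ, IsLocDomSetOn G V S ∧ S.card = k}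

/-- The locating-total domination number `γ^L_t` of the graph `G` with vertex set `V`. -/
noncomputable def locTotalDomNum (G : SimpleGraph ℕ) (V : Finset ℕ) : ℕ :=
  sInf {k | ∃ S : Finset ℕ, IsLocTotalDomSetOn G V S ∧ S.card = k}

/-- Adjacency in the infinite sibling tree, of which each `siblingTree n` is a truncation. -/
def SiblingAdj (u v : ℕ) : Prop :=
  v = 2 * u ∨ v = 2 * u + 1 ∨ u = 2 * v ∨ u = 2 * v + 1 ∨
    (∃ p, u = 2 * p ∧ v = 2 * p + 1) ∨ ∃ p, v = 2 * p ∧ u = 2 * p + 1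

lemma mem_treeVerts {n x : ℕ} : x ∈ treeVerts n ↔ 1 ≤ x ∧ x < 2 ^ (n + 1) := by
  have := Nat.one_le_two_pow (n := n + 1)
  simp only [treeVerts, Finset.mem_Icc]
  omega

lemma siblingTree_adj {n u v : ℕ} :
    (siblingTree n).Adj u v ↔ u ∈ treeVerts n ∧ v ∈ treeVerts n ∧ SiblingAdj u v := by
  have hpos : u ∈ treeVerts n → 1 ≤ u := fun hu => (mem_treeVerts.1 hu).1
  simp only [siblingTree, SimpleGraph.fromRel_adj, SiblingAdj]
  grind

/-- The total domination number of `siblingTree n` (for `n ≥ 1`), in recursive form. -/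
def siblingTotalDom : ℕ → ℕ
  | 0 => 1
  | 1 => 2
  | 2 => 2
  | m + 3 => siblingTotalDom m + 2 ^ (m + 2)

/-- A minimum total dominating set of `siblingTree n` (for `n ≥ 1`): every third level, with a
correction near the root. -/
def siblingTotalDomSet : ℕ → Finset ℕ
  | 0 => {2}
  | 1 => {2, 3}
  | 2 => {2, 3}
  | m + 3 => siblingTotalDomSet m ∪ Finset.Ico (2 ^ (m + 2)) (2 ^ (m + 3))

lemma seven_mul_siblingTotalDom (n : ℕ) :
    (n % 3 = 0 → 7 * siblingTotalDom n = 2 ^ (n + 2) + 3) ∧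
    (n % 3 = 1 → 7 * siblingTotalDom n = 2 ^ (n + 2) + 6) ∧
    (n % 3 = 2 → 7 * siblingTotalDom n + 2 = 2 ^ (n + 2)) := by
  induction n using siblingTotalDom.induct with
  | case1 => simp [siblingTotalDom]
  | case2 => simp [siblingTotalDom]
  | case3 => simp [siblingTotalDom]
  | case4 m ih =>
    rw [show m.succ.succ.succ = m + 3 from rfl]
    have h : 2 ^ (m + 3 + 2) = 8 * 2 ^ (m + 2) := by ring
    rw [siblingTotalDom, h, Nat.add_mod_right]
    omega

lemma siblingTotalDomSet_bounds (m : ℕ) :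
    ∀ x ∈ siblingTotalDomSet m, 1 ≤ x ∧ x < 2 ^ (m + 2) ∧ (1 ≤ m → x < 2 ^ (m + 1)) := by
  induction m using siblingTotalDom.induct with
  | case1 => simp [siblingTotalDomSet]
  | case2 => simp [siblingTotalDomSet]
  | case3 => simp [siblingTotalDomSet]
  | case4 m ih =>
    rw [show m.succ.succ.succ = m + 3 from rfl]
    intro x hx
    have h₁ : 2 ^ (m + 3) = 2 * 2 ^ (m + 2) := by ring
    have h₂ : 2 ^ (m + 3 + 1) = 4 * 2 ^ (m + 2) := by ring
    have h₃ : 2 ^ (m + 3 + 2) = 8 * 2 ^ (m + 2) := by ring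
    have := Nat.one_le_two_pow (n := m + 2)
    rw [siblingTotalDomSet, Finset.mem_union, Finset.mem_Ico] at hx
    rcases hx with hx | hx
    · have := ih x hx
      omega
    · omega

lemma card_siblingTotalDomSet (m : ℕ) : (siblingTotalDomSet m).card = siblingTotalDom m := by
  induction m using siblingTotalDom.induct with
  | case1 => rfl
  | case2 => rfl
  | case3 => rfl
  | case4 m ih =>
    rw [show m.succ.succ.succ = m + 3 from rfl]
    have h : 2 ^ (m + 3) = 2 * 2 ^ (m + 2) := by ring
    rw [siblingTotalDomSet, siblingTotalDom, Finset.card_union_of_disjoint, ih, Nat.card_Ico, h]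
    · omega
    · refine Finset.disjoint_left.2 fun x hx hx' => ?_
      have := siblingTotalDomSet_bounds m x hx
      rw [Finset.mem_Ico] at hx'
      omega

lemma siblingTotalDomSet_dominates (m : ℕ) :
    ∀ v, 1 ≤ v → v < 2 ^ (m + 1) → ∃ u ∈ siblingTotalDomSet m, SiblingAdj u v := by
  induction m using siblingTotalDom.induct with
  | case1 =>
    intro v h₁ h₂
    obtain rfl : v = 1 := by omega
    exact ⟨2, by simp [siblingTotalDomSet], by simp [SiblingAdj]⟩
  | case2 =>
    intro v h₁ h₂
    norm_num at h₂
    by_cases h : v = 2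
    · exact ⟨3, by simp [siblingTotalDomSet], by subst h; simp [SiblingAdj]⟩
    · refine ⟨2, by simp [siblingTotalDomSet], ?_⟩
      obtain rfl | rfl : v = 1 ∨ v = 3 := by omega
      · simp [SiblingAdj]
      · exact Or.inr (Or.inr (Or.inr (Or.inr (Or.inl ⟨1, by simp⟩))))
  | case3 =>
    intro v h₁ h₂
    norm_num at h₂
    by_cases h : v = 2 ∨ v = 6 ∨ v = 7
    · refine ⟨3, by simp [siblingTotalDomSet], ?_⟩
      rcases h with rfl | rfl | rfl <;> simp [SiblingAdj]
    · refine ⟨2, by simp [siblingTotalDomSet], ?_⟩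
      obtain rfl | rfl | rfl | rfl : v = 1 ∨ v = 3 ∨ v = 4 ∨ v = 5 := by omega
      · simp [SiblingAdj]
      · exact Or.inr (Or.inr (Or.inr (Or.inr (Or.inl ⟨1, by simp⟩))))
      · simp [SiblingAdj]
      · simp [SiblingAdj]
  | case4 m ih =>
    rw [show m.succ.succ.succ = m + 3 from rfl]
    intro v h₁ h₂
    have e₁ : 2 ^ (m + 2) = 2 * 2 ^ (m + 1) := by ring
    have e₂ : 2 ^ (m + 3) = 4 * 2 ^ (m + 1) := by ring
    have e₃ : 2 ^ (m + 3 + 1) = 8 * 2 ^ (m + 1) := by ring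
    by_cases hv : v < 2 ^ (m + 1)
    · obtain ⟨u, hu, h⟩ := ih v h₁ hv
      exact ⟨u, Finset.mem_union_left _ hu, h⟩
    · suffices ∃ u, 2 ^ (m + 2) ≤ u ∧ u < 2 ^ (m + 3) ∧ SiblingAdj u v by
        obtain ⟨u, hu, hu', h⟩ := this
        exact ⟨u, Finset.mem_union_right _ (Finset.mem_Ico.2 ⟨hu, hu'⟩), h⟩
      by_cases hv₁ : v < 2 ^ (m + 2)
      · exact ⟨2 * v, by omega, by omega, by simp [SiblingAdj]⟩
      by_cases hv₂ : v < 2 ^ (m + 3)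
      · obtain ⟨p, rfl | rfl⟩ := Nat.even_or_odd' v
        · exact ⟨2 * p + 1, by omega, by omega, by simp [SiblingAdj]⟩
        · exact ⟨2 * p, by omega, by omega, by simp [SiblingAdj]⟩
      · refine ⟨v / 2, by omega, by omega, ?_⟩
        unfold SiblingAdj
        omega

/-- The even children of the vertices of one level have disjoint open neighbourhoods. -/
lemma le_card_filter_of_dominates_level {S : Finset ℕ} {K : ℕ}
    (h : ∀ p, K ≤ p → p < 2 * K → ∃ u ∈ S, SiblingAdj u (2 * p)) :
    K ≤ (S.filter fun u => K ≤ u ∧ u < 8 * K).card := by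
  have h' : ∀ p : ℕ, ∃ u, K ≤ p → p < 2 * K →
      u ∈ S ∧ (u = p ∨ u = 2 * p + 1 ∨ u = 4 * p ∨ u = 4 * p + 1) := by
    intro p
    by_cases hp : K ≤ p ∧ p < 2 * K
    · obtain ⟨u, hu, hadj⟩ := h p hp.1 hp.2
      refine ⟨u, fun _ _ => ⟨hu, ?_⟩⟩
      rcases hadj with h | h | h | h | ⟨q, h, h'⟩ | ⟨q, h, h'⟩ <;> omega
    · exact ⟨0, fun h₁ h₂ => absurd ⟨h₁, h₂⟩ hp⟩
  choose f hf using h'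
  have hcard : (Finset.Ico K (2 * K)).card = K := by simp; omega
  conv_lhs => rw [← hcard]
  refine Finset.card_le_card_of_injOn f ?_ ?_
  · intro p hp
    simp only [Finset.coe_Ico, Set.mem_Ico] at hp
    have := hf p hp.1 hp.2
    simp only [Finset.coe_filter, Set.mem_ofPred_eq]
    exact ⟨this.1, by omega⟩
  · intro p hp q hq hpq
    simp only [Finset.coe_Ico, Set.mem_Ico] at hp hq
    have := (hf p hp.1 hp.2).2
    have := (hf q hq.1 hq.2).2
    omega

lemma siblingTotalDom_le_card_filter (S : Finset ℕ) (hS : ∀ u ∈ S, 1 ≤ u) (m : ℕ) :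
    (∀ v, 1 ≤ v → v < 2 ^ (m + 1) → ∃ u ∈ S, SiblingAdj u v) →
      siblingTotalDom m ≤ (S.filter fun u => u < 2 ^ (m + 2)).card := by
  induction m using siblingTotalDom.induct with
  | case1 =>
    intro h
    obtain ⟨u, hu, hadj⟩ := h 1 le_rfl (by norm_num)
    refine Finset.card_pos.2 ⟨u, Finset.mem_filter.2 ⟨hu, ?_⟩⟩
    have := hS u hu
    rcases hadj with h | h | h | h | ⟨q, h, h'⟩ | ⟨q, h, h'⟩ <;> omega
  | case2 =>
    intro h
    obtain ⟨u, hu, hadj⟩ := h 1 le_rfl (by norm_num)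
    have hu₁ := hS u hu
    have hu₂ : u = 2 ∨ u = 3 := by
      rcases hadj with h | h | h | h | ⟨q, h, h'⟩ | ⟨q, h, h'⟩ <;> omega
    obtain ⟨w, hw, hadj'⟩ := h u hu₁ (by norm_num; omega)
    have hw₁ := hS w hw
    refine Finset.one_lt_card.2 ⟨u, Finset.mem_filter.2 ⟨hu, by norm_num; omega⟩, w,
      Finset.mem_filter.2 ⟨hw, ?_⟩, ?_⟩ <;>
    rcases hadj' with h | h | h | h | ⟨q, h, h'⟩ | ⟨q, h, h'⟩ <;> norm_num <;> omega
  | case3 =>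
    intro h
    refine (le_card_filter_of_dominates_level (S := S) (K := 2) fun p hp hp' =>
      h _ (by omega) (by norm_num; omega)).trans (Finset.card_le_card fun x hx => ?_)
    simp only [Finset.mem_filter] at hx ⊢
    exact ⟨hx.1, by norm_num; omega⟩
  | case4 m ih =>
    rw [show m.succ.succ.succ = m + 3 from rfl]
    intro h
    have e₁ : 2 ^ (m + 2) = 2 * 2 ^ (m + 1) := by ring
    have e₂ : 2 ^ (m + 3 + 1) = 4 * 2 ^ (m + 2) := by ring
    have e₃ : 2 ^ (m + 3 + 2) = 8 * 2 ^ (m + 2) := by ring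
    have low := ih fun v hv hv' => h v hv (by omega)
    have high := le_card_filter_of_dominates_level (S := S) (K := 2 ^ (m + 2)) fun p hp hp' =>
      h _ (by omega) (by omega)
    refine (Nat.add_le_add low high).trans ?_
    rw [← Finset.card_union_of_disjoint]
    · refine Finset.card_le_card fun x hx => ?_
      simp only [Finset.mem_union, Finset.mem_filter] at hx ⊢
      rcases hx with ⟨hxS, hx⟩ | ⟨hxS, hx⟩ <;> exact ⟨hxS, by omega⟩
    · refine Finset.disjoint_left.2 fun x hx hx' => ?_
      simp only [Finset.mem_filter] at hx hx'
      omega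

lemma totalDomNum_siblingTree_eq_siblingTotalDom {n : ℕ} (hn : 1 ≤ n) :
    totalDomNum (siblingTree n) (treeVerts n) = siblingTotalDom n := by
  refine IsLeast.csInf_eq ⟨⟨siblingTotalDomSet n, ⟨fun x hx => ?_, fun v hv => ?_⟩,
    card_siblingTotalDomSet n⟩, ?_⟩
  · have := siblingTotalDomSet_bounds n x hx
    exact mem_treeVerts.2 ⟨this.1, this.2.2 hn⟩
  · have hv' := mem_treeVerts.1 hv
    obtain ⟨u, hu, hadj⟩ := siblingTotalDomSet_dominates n v hv'.1 hv'.2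
    have := siblingTotalDomSet_bounds n u hu
    exact ⟨u, hu, siblingTree_adj.2 ⟨mem_treeVerts.2 ⟨this.1, this.2.2 hn⟩, hv, hadj⟩⟩
  · rintro k ⟨S, ⟨hS, hdom⟩, rfl⟩
    refine (siblingTotalDom_le_card_filter S (fun u hu => (mem_treeVerts.1 (hS hu)).1) n
      fun v hv hv' => ?_).trans (Finset.card_filter_le _ _)
    obtain ⟨u, hu, hadj⟩ := hdom v (mem_treeVerts.2 ⟨hv, hv'⟩)
    exact ⟨u, hu, (siblingTree_adj.1 hadj).2.2⟩

/-- The total domination number of the sibling tree `ST_n`, `n ≥ 1`. -/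
theorem totalDomNum_siblingTree (n : ℕ) (hn : 1 ≤ n) :
    (n % 3 = 0 → totalDomNum (siblingTree n) (treeVerts n) = (2 ^ (n + 2) + 3) / 7) ∧
    (n % 3 = 1 → totalDomNum (siblingTree n) (treeVerts n) = (2 ^ (n + 2) - 1) / 7 + 1) ∧
    (n % 3 = 2 → totalDomNum (siblingTree n) (treeVerts n) = 2 * (2 ^ (n + 1) - 1) / 7) := by
  have h := seven_mul_siblingTotalDom n
  have e : 2 ^ (n + 2) = 2 * 2 ^ (n + 1) := by ring
  rw [totalDomNum_siblingTree_eq_siblingTotalDom hn]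
  omega
end

section
/- Let G be the sibling tree ST_3. Then the locating-domination number γ^L(G) = 6. -/
theorem siblingTree_three_adj (x y : ℕ) :
    (siblingTree 3).Adj x y ↔ (1 ≤ x ∧ x ≤ 15 ∧ 1 ≤ y ∧ y ≤ 15) ∧
      (y = 2 * x ∨ y = 2 * x + 1 ∨ (x % 2 = 0 ∧ y = x + 1) ∨
        x = 2 * y ∨ x = 2 * y + 1 ∨ (y % 2 = 0 ∧ x = y + 1)) := by
  have key : ∀ a b : ℕ, (∃ p, a = 2 * p ∧ b = 2 * p + 1) ↔ (a % 2 = 0 ∧ b = a + 1) :=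
    fun a b => ⟨by rintro ⟨p, h⟩; omega, fun h => ⟨a / 2, by omega⟩⟩
  simp only [siblingTree, SimpleGraph.fromRel_adj, key, treeVerts, Finset.mem_Icc]
  omega

theorem LocatesOn.exists_mem_not_iff {G : SimpleGraph ℕ} {V S : Finset ℕ}
    (h : LocatesOn G V S) {u v : ℕ} (hu : u ∈ V) (hv : v ∈ V) (hu' : u ∉ S) (hv' : v ∉ S)
    (huv : u ≠ v) : ∃ w ∈ S, ¬(G.Adj w u ↔ G.Adj w v) := by
  by_contra! hc
  exact h u hu v hv hu' hv' huv (Set.ext fun w => and_congr_right (hc w))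

/-- One of two sibling leaves belongs to every locating set, as they have the same
closed neighborhood. -/
theorem LocatesOn.mem_or_mem_of_sibling_leaves {S : Finset ℕ}
    (h : LocatesOn (siblingTree 3) (treeVerts 3) S) {q : ℕ} (hq : 4 ≤ q) (hq' : q ≤ 7) :
    2 * q ∈ S ∨ 2 * q + 1 ∈ S := by
  by_contra! hc
  obtain ⟨w, hw, hne⟩ := h.exists_mem_not_iff (by simp [treeVerts]; omega)
    (by simp [treeVerts]; omega) hc.1 hc.2 (by omega)
  have h1 : w ≠ 2 * q := fun e => hc.1 (e ▸ hw)
  have h2 : w ≠ 2 * q + 1 := fun e => hc.2 (e ▸ hw)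
  simp only [siblingTree_three_adj] at hne
  omega

/-- A locating set contains three vertices of the subtree rooted at a child of the root. -/
theorem LocatesOn.three_le_card_subtree {S : Finset ℕ}
    (h : LocatesOn (siblingTree 3) (treeVerts 3) S) {p : ℕ} (hp : p = 2 ∨ p = 3) :
    3 ≤ (S.filter fun w => w = p ∨ w / 2 = p ∨ w / 4 = p).card := by
  obtain ⟨a, ha, haq⟩ : ∃ a ∈ S, a / 2 = 2 * p := by
    rcases h.mem_or_mem_of_sibling_leaves (q := 2 * p) (by omega) (by omega) with h | h
    · exact ⟨_, h, by omega⟩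
    · exact ⟨_, h, by omega⟩
  obtain ⟨b, hb, hbq⟩ : ∃ b ∈ S, b / 2 = 2 * p + 1 := by
    rcases h.mem_or_mem_of_sibling_leaves (q := 2 * p + 1) (by omega) (by omega) with h | h
    · exact ⟨_, h, by omega⟩
    · exact ⟨_, h, by omega⟩
  obtain ⟨c, hc, hca, hcb, hcp⟩ :
      ∃ c ∈ S, c ≠ a ∧ c ≠ b ∧ (c = p ∨ c / 2 = p ∨ c / 4 = p) := by
    by_cases h4 : 2 * p ∈ S
    · exact ⟨_, h4, by omega, by omega, by omega⟩
    obtain ⟨a', haa', haq'⟩ : ∃ a', a' ≠ a ∧ a' / 2 = 2 * p :=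
      ⟨8 * p + 1 - a, by omega, by omega⟩
    by_cases h8 : a' ∈ S
    · exact ⟨_, h8, haa', by omega, by omega⟩
    obtain ⟨w, hw, hne⟩ := h.exists_mem_not_iff (by simp [treeVerts]; omega)
      (by simp [treeVerts]; omega) h4 h8 (by omega)
    have h1 : w ≠ 2 * p := fun e => h4 (e ▸ hw)
    have h2 : w ≠ a' := fun e => h8 (e ▸ hw)
    simp only [siblingTree_three_adj] at hne
    exact ⟨w, hw, by omega, by omega, by omega⟩
  have hcard : ({a, b, c} : Finset ℕ).card = 3 :=
    Finset.card_eq_three.2 ⟨a, b, c, by omega, hca.symm, hcb.symm, rfl⟩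
  rw [← hcard]
  refine Finset.card_le_card fun w hw => ?_
  simp only [Finset.mem_insert, Finset.mem_singleton] at hw
  rcases hw with rfl | rfl | rfl
  · exact Finset.mem_filter.2 ⟨ha, by omega⟩
  · exact Finset.mem_filter.2 ⟨hb, by omega⟩
  · exact Finset.mem_filter.2 ⟨hc, hcp⟩

theorem LocatesOn.six_le_card {S : Finset ℕ}
    (h : LocatesOn (siblingTree 3) (treeVerts 3) S) : 6 ≤ S.card := by
  have h2 := h.three_le_card_subtree (Or.inl rfl)
  have h3 := h.three_le_card_subtree (Or.inr rfl)
  have hd : Disjoint (S.filter fun w => w = 2 ∨ w / 2 = 2 ∨ w / 4 = 2)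
      (S.filter fun w => w = 3 ∨ w / 2 = 3 ∨ w / 4 = 3) :=
    Finset.disjoint_filter.2 fun w _ => by omega
  have hle := Finset.card_le_card (Finset.union_subset
    (Finset.filter_subset (fun w => w = 2 ∨ w / 2 = 2 ∨ w / 4 = 2) S)
    (Finset.filter_subset (fun w => w = 3 ∨ w / 2 = 3 ∨ w / 4 = 3) S))
  rw [Finset.card_union_of_disjoint hd] at hle
  omega

theorem isLocDomSetOn_siblingTree_three :
    IsLocDomSetOn (siblingTree 3) (treeVerts 3) {2, 3, 8, 10, 12, 14} := by
  refine ⟨⟨by decide, ?_⟩, fun u hu v hv hu' hv' huv heq => ?_⟩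
  · simp only [siblingTree_three_adj, treeVerts]
    decide
  · have hsep : ∀ u ∈ Finset.Icc 1 15, ∀ v ∈ Finset.Icc 1 15,
        u ∉ ({2, 3, 8, 10, 12, 14} : Finset ℕ) → v ∉ ({2, 3, 8, 10, 12, 14} : Finset ℕ) →
        u ≠ v → ∃ w ∈ ({2, 3, 8, 10, 12, 14} : Finset ℕ),
          ¬((siblingTree 3).Adj w u ↔ (siblingTree 3).Adj w v) := by
      simp only [siblingTree_three_adj]
      decide +kernel
    obtain ⟨w, hw, hne⟩ := hsep u hu v hv hu' hv' huv
    have hiff := Set.ext_iff.1 heq w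
    simp only [Set.mem_ofPred_eq, hw, true_and] at hiff
    exact hne hiff

/-- The sibling tree `ST_3` has locating-domination number 6. -/
theorem locDomNum_siblingTree_three :
    locDomNum (siblingTree 3) (treeVerts 3) = 6 := by
  refine le_antisymm (Nat.sInf_le ⟨_, isLocDomSetOn_siblingTree_three, rfl⟩) ?_
  refine le_csInf ⟨_, _, isLocDomSetOn_siblingTree_three, rfl⟩ ?_
  rintro k ⟨S, hS, rfl⟩
  exact hS.2.six_le_card
end

section
/- Let G be the sibling tree ST_n with n ≥ 1, and let S be a locating-dominating set of G of minimum cardinality (i.e. |S| = γ^L(G)). Then S contains at least 2^{n-1} vertices whose labels lie in level n, i.e. |S ∩ {x : 2^{n} ≤ x ≤ 2^{n+1}-1}| ≥ 2^{n-1}. -/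
/-- The two children of a vertex at the level before the last are twins in the sibling tree. -/
theorem siblingTree_adj_children_iff {n p w : ℕ} (hp : 2 ^ n ≤ 2 * p) (hp' : 2 * p < 2 ^ (n + 1))
    (h₀ : w ≠ 2 * p) (h₁ : w ≠ 2 * p + 1) :
    (siblingTree n).Adj w (2 * p) ↔ (siblingTree n).Adj w (2 * p + 1) := by
  simp only [siblingTree, SimpleGraph.fromRel_adj, treeVerts, Finset.mem_Icc]
  have hpow : 2 ^ (n + 1) = 2 * 2 ^ n := by ring
  constructor
  · rintro ⟨-, h | h⟩
    · obtain ⟨hw, -, h | h | ⟨q, h, h'⟩⟩ := h <;>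
        exact ⟨h₁, Or.inl ⟨hw, by omega, by omega⟩⟩
    · obtain ⟨-, hw, h | h | ⟨q, h, h'⟩⟩ := h <;> omega
  · rintro ⟨-, h | h⟩
    · obtain ⟨hw, -, h | h | ⟨q, h, h'⟩⟩ := h <;>
        exact ⟨h₀, Or.inl ⟨hw, by omega, by omega⟩⟩
    · obtain ⟨-, hw, h | h | ⟨q, h, h'⟩⟩ := h <;> omega

/-- A locating set of the sibling tree contains one of any two sibling leaves. -/
theorem LocatesOn.mem_or_mem_of_siblingTree {n p : ℕ} {S : Finset ℕ}
    (hS : LocatesOn (siblingTree n) (treeVerts n) S)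
    (hp : 2 ^ n ≤ 2 * p) (hp' : 2 * p < 2 ^ (n + 1)) : 2 * p ∈ S ∨ 2 * p + 1 ∈ S := by
  by_contra! h
  have hpos : 0 < 2 ^ n := by positivity
  have hpow : 2 ^ (n + 1) = 2 * 2 ^ n := by ring
  refine hS (2 * p) (Finset.mem_Icc.2 (by omega)) (2 * p + 1) (Finset.mem_Icc.2 (by omega))
    h.1 h.2 (by omega) (Set.ext fun w => and_congr_right fun hw => ?_)
  exact siblingTree_adj_children_iff hp hp' (fun e => h.1 (e ▸ hw)) (fun e => h.2 (e ▸ hw))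

/-- Any minimum locating-dominating set of the sibling tree `ST_n`, `n ≥ 1`, contains
at least `2^(n-1)` vertices from level `n`. -/
theorem minLocDomSet_siblingTree_lastLevel (n : ℕ) (hn : 1 ≤ n) (S : Finset ℕ)
    (hS : IsLocDomSetOn (siblingTree n) (treeVerts n) S)
    (hmin : S.card = locDomNum (siblingTree n) (treeVerts n)) :
    2 ^ (n - 1) ≤ (S ∩ Finset.Icc (2 ^ n) (2 ^ (n + 1) - 1)).card := by
  obtain ⟨m, rfl⟩ := Nat.exists_eq_add_of_le' hn
  have hpow : 2 ^ (m + 1) = 2 * 2 ^ m := by ring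
  have hpow' : 2 ^ (m + 1 + 1) = 2 * 2 ^ (m + 1) := by ring
  have hcard : (Finset.Ico (2 ^ m) (2 ^ (m + 1))).card = 2 ^ m := by
    rw [Nat.card_Ico]
    omega
  rw [Nat.add_sub_cancel, ← hcard]
  refine Finset.card_le_card_of_surjOn (· / 2) fun p hp => ?_
  rw [Finset.mem_coe, Finset.mem_Ico] at hp
  rcases hS.2.mem_or_mem_of_siblingTree (p := p) (by omega) (by omega) with h | h
  · exact ⟨2 * p, Finset.mem_inter.2 ⟨h, Finset.mem_Icc.2 (by omega)⟩, by grind⟩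
  · exact ⟨2 * p + 1, Finset.mem_inter.2 ⟨h, Finset.mem_Icc.2 (by omega)⟩, by grind⟩
end

section
/- Let G be the sibling tree ST_n with n ≥ 1, and let S be a locating-total dominating set of G of minimum cardinality (i.e. |S| = γ^L_t(G)). Then S contains at least 2^{n} vertices whose labels lie in levels n-1 and n, i.e. |S ∩ {x : 2^{n-1} ≤ x ≤ 2^{n+1}-1}| ≥ 2^{n}. -/
/-- The neighbours of a left leaf `2p` of the sibling tree are its parent and its sibling. -/
theorem siblingTree_adj_two_mul_leaf {n p : ℕ} (h1 : 1 ≤ p) (hp : 2 ^ n ≤ 2 * p)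
    (hp' : p < 2 ^ n) (w : ℕ) :
    (siblingTree n).Adj w (2 * p) ↔ w = p ∨ w = 2 * p + 1 := by
  simp only [siblingTree, SimpleGraph.fromRel_adj, treeVerts, Finset.mem_Icc, pow_succ]
  constructor
  · rintro ⟨_, ⟨_, _, _ | _ | ⟨q, _, _⟩⟩ | ⟨_, _, _ | _ | ⟨q, _, _⟩⟩⟩ <;> omega
  · rintro (rfl | rfl)
    · exact ⟨by omega, .inl ⟨by omega, by omega, .inl rfl⟩⟩
    · exact ⟨by omega, .inr ⟨by omega, by omega, .inr (.inr ⟨p, rfl, rfl⟩)⟩⟩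

/-- The neighbours of a right leaf `2p + 1` of the sibling tree are its parent and its sibling. -/
theorem siblingTree_adj_two_mul_add_one_leaf {n p : ℕ} (h1 : 1 ≤ p) (hp : 2 ^ n ≤ 2 * p)
    (hp' : p < 2 ^ n) (w : ℕ) :
    (siblingTree n).Adj w (2 * p + 1) ↔ w = p ∨ w = 2 * p := by
  simp only [siblingTree, SimpleGraph.fromRel_adj, treeVerts, Finset.mem_Icc, pow_succ]
  constructor
  · rintro ⟨_, ⟨_, _, _ | _ | ⟨q, _, _⟩⟩ | ⟨_, _, _ | _ | ⟨q, _, _⟩⟩⟩ <;> omega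
  · rintro (rfl | rfl)
    · exact ⟨by omega, .inl ⟨by omega, by omega, .inr (.inl rfl)⟩⟩
    · exact ⟨by omega, .inl ⟨by omega, by omega, .inr (.inr ⟨p, rfl, rfl⟩)⟩⟩

/-- A locating-total dominating set of the sibling tree contains at least two vertices of every
triangle formed by two sibling leaves and their parent. -/
theorem IsLocTotalDomSetOn.exists_pair_leaf_triangle {n p : ℕ} {S : Finset ℕ}
    (hS : IsLocTotalDomSetOn (siblingTree n) (treeVerts n) S)
    (h1 : 1 ≤ p) (hp : 2 ^ n ≤ 2 * p) (hp' : p < 2 ^ n) :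
    ∃ a ∈ S, ∃ b ∈ S, a ≠ b ∧ (a = p ∨ a = 2 * p ∨ a = 2 * p + 1) ∧
      (b = p ∨ b = 2 * p ∨ b = 2 * p + 1) := by
  obtain ⟨⟨-, hdom⟩, hloc⟩ := hS
  have hl : 2 * p ∈ treeVerts n := by
    simp only [treeVerts, Finset.mem_Icc, pow_succ]; omega
  have hr : 2 * p + 1 ∈ treeVerts n := by
    simp only [treeVerts, Finset.mem_Icc, pow_succ]; omega
  by_cases hlS : 2 * p ∈ S
  · obtain ⟨u, hu, hadj⟩ := hdom _ hl
    rw [siblingTree_adj_two_mul_leaf h1 hp hp'] at hadj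
    exact ⟨2 * p, hlS, u, hu, by omega, by omega, by omega⟩
  by_cases hrS : 2 * p + 1 ∈ S
  · obtain ⟨u, hu, hadj⟩ := hdom _ hr
    rw [siblingTree_adj_two_mul_add_one_leaf h1 hp hp'] at hadj
    exact ⟨2 * p + 1, hrS, u, hu, by omega, by omega, by omega⟩
  refine absurd ?_ (hloc _ hl _ hr hlS hrS (by omega))
  ext w
  simp only [Set.mem_ofPred_eq, siblingTree_adj_two_mul_leaf h1 hp hp',
    siblingTree_adj_two_mul_add_one_leaf h1 hp hp']
  grind

/-- Any minimum locating-total dominating set of the sibling tree `ST_n`, `n ≥ 1`,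
contains at least `2^n` vertices from levels `n-1` and `n`. -/
theorem minLocTotalDomSet_siblingTree_lastTwoLevels (n : ℕ) (hn : 1 ≤ n) (S : Finset ℕ)
    (hS : IsLocTotalDomSetOn (siblingTree n) (treeVerts n) S)
    (hmin : S.card = locTotalDomNum (siblingTree n) (treeVerts n)) :
    2 ^ n ≤ (S ∩ Finset.Icc (2 ^ (n - 1)) (2 ^ (n + 1) - 1)).card := by
  obtain ⟨m, rfl⟩ : ∃ m, n = m + 1 := ⟨n - 1, by omega⟩
  have hpos : 1 ≤ 2 ^ m := Nat.one_le_two_pow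
  simp only [Nat.add_sub_cancel]
  have hmaps : ∀ x ∈ S ∩ Finset.Icc (2 ^ m) (2 ^ (m + 1 + 1) - 1),
      (if x < 2 ^ (m + 1) then x else x / 2) ∈ Finset.Ico (2 ^ m) (2 ^ (m + 1)) := by
    intro x hx
    simp only [Finset.mem_inter, Finset.mem_Icc, Finset.mem_Ico, pow_succ] at hx ⊢
    split_ifs <;> omega
  rw [Finset.card_eq_sum_card_fiberwise hmaps]
  have hfiber : ∀ p ∈ Finset.Ico (2 ^ m) (2 ^ (m + 1)),
      2 ≤ ((S ∩ Finset.Icc (2 ^ m) (2 ^ (m + 1 + 1) - 1)).filter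
        fun x => (if x < 2 ^ (m + 1) then x else x / 2) = p).card := by
    intro p hp
    rw [Finset.mem_Ico] at hp
    obtain ⟨a, ha, b, hb, hab, hap, hbp⟩ :=
      hS.exists_pair_leaf_triangle (p := p) (by omega) (by rw [pow_succ]; omega) hp.2
    refine Finset.one_lt_card.2 ⟨a, ?_, b, ?_, hab⟩ <;>
    · simp only [Finset.mem_filter, Finset.mem_inter, Finset.mem_Icc, pow_succ] at hp ⊢
      refine ⟨⟨by assumption, by omega⟩, ?_⟩
      split_ifs <;> omega
  refine le_trans (le_of_eq ?_) (Finset.card_nsmul_le_sum _ _ 2 hfiber)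
  rw [Nat.card_Ico, smul_eq_mul, pow_succ]
  omega
end
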